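/- For all integers q and z with 2 ≤ z ≤ q - 1 and q ≥ 3, the inequality (q - z) * q^(z-1) < (q - 1)^z holds. -/

import Mathlib

/-- With `q = p + 1` and `z = n + 2`, the inequality holds over `ℤ` without an upper bound on `z`. -/
lemma sub_mul_succ_pow_lt_pow (p : ℤ) (hp : 0 < p) (n : ℕ) :
    (p - 1 - n) * (p + 1) ^ (n + 1) < p ^ (n + 2) := by
  induction n with
  | zero => norm_num; nlinarith
  | succ n ih =>
    have h : 0 < (p + 1) ^ (n + 1) := by positivity
    calc (p - 1 - (n + 1 : ℕ)) * (p + 1) ^ (n + 1 + 1)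
        = p * ((p - 1 - n) * (p + 1) ^ (n + 1)) - (n + 2) * (p + 1) ^ (n + 1) := by
          push_cast; ring
      _ ≤ p * ((p - 1 - n) * (p + 1) ^ (n + 1)) := sub_le_self _ (by positivity)
      _ < p * p ^ (n + 2) := by gcongr
      _ = p ^ (n + 1 + 2) := by ring

/-- Proposition 1: for integers `q ≥ 3` and `2 ≤ z ≤ q - 1`,
`(q - z) * q^(z-1) < (q - 1)^z`. -/
theorem stmt_0 (q z : ℕ) (hq : 3 ≤ q) (hz : 2 ≤ z) (hzq : z ≤ q - 1) :
    (q - z) * q ^ (z - 1) < (q - 1) ^ z := by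
  obtain ⟨n, rfl⟩ := Nat.exists_eq_add_of_le' hz
  obtain ⟨p, rfl⟩ := Nat.exists_eq_add_of_le' (show 1 ≤ q by omega)
  have h := sub_mul_succ_pow_lt_pow p (by omega) n
  have hsub : ((p + 1 - (n + 2) : ℕ) : ℤ) = p - 1 - n := by omega
  rw [← hsub] at h
  exact_mod_cast h
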